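/- Let A ⊆ V be a nonempty finite set, W ⊆ V a finite set with A ⊆ W, z ∈ W, and let (Y_j)_{j≥0} be a Markov chain on S = B₁W with kernel p_W started at z. Let τ := inf{j ≥ 0 : Y_j ∈ A}. Then τ is almost surely finite, and for every φ : A → ℝ, E[φ(Y_τ)] = h^φ(z), where h^φ is the energy-minimizing function on V with boundary values φ on A. (The paper's Lemma 3.2: the hitting distribution of A for the chain equals the energy-minimizing harmonic measure.) -/

import Mathlib

open scoped ENNReal

noncomputable section

/-- The Dirichlet energy `(1/2) Σ_{x,y} c(x,y) (f(y) - f(x))²`, valued in `[0,∞]`. -/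
def energy {V : Type*} (c : V → V → ℝ) (f : V → ℝ) : ℝ≥0∞ :=
  (1 / 2 : ℝ≥0∞) * ∑' x : V, ∑' y : V, ENNReal.ofReal (c x y * (f y - f x) ^ 2)

/-- A conductance function: symmetric, nonnegative, vanishing on the diagonal,
connected (via the adjacency relation `0 < c x y`), and with `π(x) = Σ_y c(x,y) < ∞`
for every `x` (expressed as summability of the nonnegative family `c x ·`). -/
def Conductance {V : Type*} (c : V → V → ℝ) : Prop :=
  (∀ x y, c x y = c y x) ∧ (∀ x y, 0 ≤ c x y) ∧ (∀ x, c x x = 0) ∧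
  (∀ x y, Relation.ReflTransGen (fun a b => 0 < c a b) x y) ∧
  (∀ x, Summable fun y => c x y)


open MeasureTheory
open scoped Classical

/-- The `1`-neighborhood `B₁W = W ∪ {x : x ∼ y for some y ∈ W}` of a finite set `W`. -/
def B1 {V : Type*} (c : V → V → ℝ) (W : Finset V) : Set V :=
  ↑W ∪ {x | ∃ y ∈ W, 0 < c x y}

/-- The transition kernel `p_W`: from `x ∈ W`, random-walk steps `c(x,y)/π(x)`;
from `x ∉ W`, jump into `W` according to the energy-minimizing harmonic measure
`hm_W^x(y) = H y x` (and probability `0` to points outside `W`). -/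
def pW {V : Type*} (c : V → V → ℝ) (W : Finset V) (H : V → V → ℝ) (x y : V) : ℝ :=
  if x ∈ W then c x y / (∑' z, c x z) else if y ∈ W then H y x else 0

namespace DirichletForm

variable {V : Type*} {c : V → V → ℝ}

/-- Functions of finite Dirichlet energy. -/
def FiniteEnergy (c : V → V → ℝ) (f : V → ℝ) : Prop :=
  Summable fun p : V × V => c p.1 p.2 * (f p.2 - f p.1) ^ 2

/-- The symmetric bilinear form whose diagonal is twice the Dirichlet energy. -/
def form (c : V → V → ℝ) (f g : V → ℝ) : ℝ :=
  ∑' p : V × V, c p.1 p.2 * (f p.2 - f p.1) * (g p.2 - g p.1)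

theorem FiniteEnergy.smul {f : V → ℝ} (hf : FiniteEnergy c f) (t : ℝ) :
    FiniteEnergy c (t • f) := by
  refine (hf.mul_left (t ^ 2)).congr fun p => ?_
  simp only [Pi.smul_apply, smul_eq_mul]
  ring

theorem FiniteEnergy.add (hc : Conductance c) {f g : V → ℝ} (hf : FiniteEnergy c f)
    (hg : FiniteEnergy c g) : FiniteEnergy c (f + g) := by
  refine Summable.of_nonneg_of_le (fun p => mul_nonneg (hc.2.1 _ _) (sq_nonneg _)) (fun p => ?_)
    ((Summable.add hf hg).mul_left 2)
  have h := mul_nonneg (hc.2.1 p.1 p.2) (sq_nonneg ((f p.2 - f p.1) - (g p.2 - g p.1)))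
  simp only [Pi.add_apply]
  nlinarith

theorem finiteEnergy_const (b : ℝ) : FiniteEnergy c fun _ => b := by
  simp [FiniteEnergy, summable_zero]

theorem FiniteEnergy.sum (hc : Conductance c) {ι : Type*} (s : Finset ι) {f : ι → V → ℝ}
    (hf : ∀ i ∈ s, FiniteEnergy c (f i)) : FiniteEnergy c (∑ i ∈ s, f i) :=
  Finset.sum_induction f (FiniteEnergy c) (fun _ _ => FiniteEnergy.add hc)
    (finiteEnergy_const 0) hf

theorem FiniteEnergy.summable_mul (hc : Conductance c) {f g : V → ℝ} (hf : FiniteEnergy c f)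
    (hg : FiniteEnergy c g) :
    Summable fun p : V × V => c p.1 p.2 * (f p.2 - f p.1) * (g p.2 - g p.1) := by
  refine Summable.of_norm_bounded (Summable.add hf hg) fun p => ?_
  have h0 := hc.2.1 p.1 p.2
  have h1 := mul_nonneg h0 (sq_nonneg ((f p.2 - f p.1) - (g p.2 - g p.1)))
  have h2 := mul_nonneg h0 (sq_nonneg ((f p.2 - f p.1) + (g p.2 - g p.1)))
  have h3 := mul_nonneg h0 (sq_nonneg (f p.2 - f p.1))
  have h4 := mul_nonneg h0 (sq_nonneg (g p.2 - g p.1))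
  rw [Real.norm_eq_abs, abs_le]
  constructor <;> nlinarith

theorem form_comm (f g : V → ℝ) : form c f g = form c g f :=
  tsum_congr fun p => by ring

theorem form_smul_left (t : ℝ) (f g : V → ℝ) : form c (t • f) g = t * form c f g := by
  rw [form, form, ← tsum_mul_left]
  refine tsum_congr fun p => ?_
  simp only [Pi.smul_apply, smul_eq_mul]
  ring

theorem form_add_left (hc : Conductance c) {f g u : V → ℝ} (hf : FiniteEnergy c f)
    (hg : FiniteEnergy c g) (hu : FiniteEnergy c u) :
    form c (f + g) u = form c f u + form c g u := by
  rw [form, form, form, ← (hf.summable_mul hc hu).tsum_add (hg.summable_mul hc hu)]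
  refine tsum_congr fun p => ?_
  simp only [Pi.add_apply]
  ring

theorem form_const_left (b : ℝ) (u : V → ℝ) : form c (fun _ => b) u = 0 := by
  simp [form]

theorem form_sum_left (hc : Conductance c) {ι : Type*} (s : Finset ι) {f : ι → V → ℝ}
    {u : V → ℝ} (hf : ∀ i ∈ s, FiniteEnergy c (f i)) (hu : FiniteEnergy c u) :
    form c (∑ i ∈ s, f i) u = ∑ i ∈ s, form c (f i) u := by
  induction s using Finset.induction_on with
  | empty => exact form_const_left 0 u
  | insert a s ha ih =>
    rw [Finset.sum_insert ha, Finset.sum_insert ha, form_add_left hc (hf a (by simp))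
      (FiniteEnergy.sum hc s fun i hi => hf i (by simp [hi])) hu,
      ih fun i hi => hf i (by simp [hi])]

theorem form_self_nonneg (hc : Conductance c) (f : V → ℝ) : 0 ≤ form c f f :=
  tsum_nonneg fun p => by
    rw [mul_assoc]
    exact mul_nonneg (hc.2.1 _ _) (mul_self_nonneg _)

theorem energy_eq_tsum_prod (f : V → ℝ) :
    energy c f = (1 / 2 : ℝ≥0∞) *
      ∑' p : V × V, ENNReal.ofReal (c p.1 p.2 * (f p.2 - f p.1) ^ 2) := by
  rw [energy, ENNReal.tsum_prod']

theorem FiniteEnergy.energy_eq (hc : Conductance c) {f : V → ℝ} (hf : FiniteEnergy c f) :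
    energy c f = ENNReal.ofReal (form c f f / 2) := by
  have h : form c f f = ∑' p : V × V, c p.1 p.2 * (f p.2 - f p.1) ^ 2 :=
    tsum_congr fun p => by ring
  rw [energy_eq_tsum_prod, ← ENNReal.ofReal_tsum_of_nonneg
    (fun p => mul_nonneg (hc.2.1 _ _) (sq_nonneg _)) hf, h, div_eq_inv_mul,
    ENNReal.ofReal_mul (by norm_num), ENNReal.ofReal_inv_of_pos (by norm_num)]
  simp

theorem finiteEnergy_of_energy_ne_top (hc : Conductance c) {f : V → ℝ} (h : energy c f ≠ ⊤) :
    FiniteEnergy c f := by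
  rw [energy_eq_tsum_prod] at h
  have h' : ∑' p : V × V, ENNReal.ofReal (c p.1 p.2 * (f p.2 - f p.1) ^ 2) ≠ ⊤ := by
    intro h'
    rw [h'] at h
    exact h (ENNReal.mul_top (by simp))
  refine (ENNReal.summable_toReal h').congr fun p => ?_
  rw [ENNReal.toReal_ofReal (mul_nonneg (hc.2.1 _ _) (sq_nonneg _))]

theorem FiniteEnergy.summable_mul_sub (hc : Conductance c) {f : V → ℝ} (hf : FiniteEnergy c f)
    (x : V) : Summable fun y => c x y * (f y - f x) := by
  have h1 : Summable fun y => c x y * (f y - f x) ^ 2 :=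
    hf.comp_injective (Prod.mk_right_injective x)
  refine Summable.of_norm_bounded ((hc.2.2.2.2 x).add h1) fun y => ?_
  have h0 := hc.2.1 x y
  have h2 := mul_nonneg h0 (sq_nonneg ((f y - f x) - 1))
  have h3 := mul_nonneg h0 (sq_nonneg ((f y - f x) + 1))
  have h4 := mul_nonneg h0 (sq_nonneg (f y - f x))
  rw [Real.norm_eq_abs, abs_le]
  constructor <;> nlinarith

theorem hasSum_ite_fst_eq {g : V × V → ℝ} {x : V} (hg : Summable fun y => g (x, y)) :
    HasSum (fun p : V × V => if p.1 = x then g p else 0) (∑' y, g (x, y)) := by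
  rw [← (Prod.mk_right_injective x).hasSum_iff]
  · refine hg.hasSum.congr_fun fun y => ?_
    simp
  · rintro ⟨a, b⟩ hab
    refine if_neg fun h => hab ⟨b, ?_⟩
    simp_all

theorem finiteEnergy_single (hc : Conductance c) (x : V) :
    FiniteEnergy c (Pi.single x (1 : ℝ)) := by
  have h1 := (hasSum_ite_fst_eq (g := fun p => c p.1 p.2) (hc.2.2.2.2 x)).summable
  have h2 := (Equiv.prodComm V V).summable_iff.2 h1
  refine Summable.of_nonneg_of_le (fun p => mul_nonneg (hc.2.1 _ _) (sq_nonneg _)) (fun p => ?_)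
    (h1.add h2)
  have h0 := hc.2.1 p.1 p.2
  have h3 := hc.1 p.1 p.2
  simp only [Pi.single_apply, Function.comp_apply, Equiv.prodComm_apply, Prod.fst_swap,
    Prod.snd_swap]
  by_cases h1 : p.1 = x <;> by_cases h2 : p.2 = x <;> simp [h1, h2] <;> simp_all

theorem form_single (hc : Conductance c) {f : V → ℝ} (hf : FiniteEnergy c f) (x : V) :
    form c f (Pi.single x (1 : ℝ)) = -2 * ∑' y, c x y * (f y - f x) := by
  have h1 := hasSum_ite_fst_eq (g := fun p => c p.1 p.2 * (f p.2 - f p.1)) (x := x)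
    (hf.summable_mul_sub hc x)
  have h2 := (Equiv.prodComm V V).hasSum_iff.2 h1
  refine ((h1.add h2).neg.congr_fun fun p => ?_).tsum_eq.trans (by ring)
  simp only [Pi.single_apply, Function.comp_apply, Equiv.prodComm_apply, Prod.fst_swap,
    Prod.snd_swap, hc.1 p.2 p.1]
  split_ifs <;> ring

theorem eq_of_form_self_nonpos (hc : Conductance c) {u : V → ℝ} (hu : FiniteEnergy c u)
    (h : form c u u ≤ 0) (x y : V) : u x = u y := by
  have hnn : ∀ p : V × V, 0 ≤ c p.1 p.2 * (u p.2 - u p.1) * (u p.2 - u p.1) := fun p => by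
    rw [mul_assoc]
    exact mul_nonneg (hc.2.1 _ _) (mul_self_nonneg _)
  have h0 := (hu.summable_mul hc hu).hasSum
  rw [← form, le_antisymm h (form_self_nonneg hc u), hasSum_zero_iff_of_nonneg hnn] at h0
  induction hc.2.2.2.1 x y with
  | refl => rfl
  | @tail a b _ hab ih =>
    have h1 : c a b * (u b - u a) * (u b - u a) = 0 := congrFun h0 (a, b)
    simp only [mul_eq_zero, hab.ne', false_or, or_self] at h1
    linarith

theorem FiniteEnergy.posPart_sub (hc : Conductance c) {f : V → ℝ} (hf : FiniteEnergy c f)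
    (m : ℝ) : FiniteEnergy c fun x => max (f x - m) 0 := by
  refine Summable.of_nonneg_of_le (fun p => mul_nonneg (hc.2.1 _ _) (sq_nonneg _)) (fun p => ?_)
    hf
  refine mul_le_mul_of_nonneg_left ?_ (hc.2.1 _ _)
  rw [sq_le_sq]
  refine (abs_max_sub_max_le_abs _ _ _).trans (le_of_eq ?_)
  congr 1
  ring

/-- Maximum principle: a function which is subharmonic where it exceeds `m` stays below `m`. -/
theorem le_of_form_posPart_nonpos (hc : Conductance c) {F : V → ℝ} (hF : FiniteEnergy c F)
    {a : V} {m : ℝ} (ha : F a ≤ m) (h : form c F (fun x => max (F x - m) 0) ≤ 0) (x : V) :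
    F x ≤ m := by
  have hu := hF.posPart_sub hc m
  set u : V → ℝ := fun x => max (F x - m) 0 with hu_def
  have hle : form c u u ≤ form c F u := by
    refine (hu.summable_mul hc hu).tsum_le_tsum (fun p => ?_) (hF.summable_mul hc hu)
    rw [mul_assoc, mul_assoc]
    refine mul_le_mul_of_nonneg_left ?_ (hc.2.1 _ _)
    simp only [hu_def]
    rcases max_cases (F p.2 - m) 0 with ⟨h1, h2⟩ | ⟨h1, h2⟩ <;>
      rcases max_cases (F p.1 - m) 0 with ⟨h3, h4⟩ | ⟨h3, h4⟩ <;> rw [h1, h3] <;> nlinarith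
  have hxa := eq_of_form_self_nonpos hc hu (hle.trans h) x a
  simp only [hu_def, max_eq_right (sub_nonpos.2 ha)] at hxa
  linarith [le_max_left (F x - m) 0]

/-- Finite-energy functions that are harmonic off `A` in the weak (variational) sense. -/
def HarmonicOff (c : V → V → ℝ) (A : Finset V) (F : V → ℝ) : Prop :=
  FiniteEnergy c F ∧ ∀ u, FiniteEnergy c u → (∀ a ∈ A, u a = 0) → form c F u = 0

variable {A W : Finset V}

theorem harmonicOff_const (b : ℝ) : HarmonicOff c A fun _ => b :=
  ⟨finiteEnergy_const b, fun u _ _ => form_const_left b u⟩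

theorem HarmonicOff.smul {F : V → ℝ} (hF : HarmonicOff c A F) (t : ℝ) :
    HarmonicOff c A (t • F) :=
  ⟨hF.1.smul t, fun u hu h => by rw [form_smul_left, hF.2 u hu h, mul_zero]⟩

theorem HarmonicOff.add (hc : Conductance c) {F G : V → ℝ} (hF : HarmonicOff c A F)
    (hG : HarmonicOff c A G) : HarmonicOff c A (F + G) :=
  ⟨hF.1.add hc hG.1, fun u hu h => by
    rw [form_add_left hc hF.1 hG.1 hu, hF.2 u hu h, hG.2 u hu h, add_zero]⟩

theorem HarmonicOff.sum (hc : Conductance c) {ι : Type*} (s : Finset ι) {F : ι → V → ℝ}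
    (hF : ∀ i ∈ s, HarmonicOff c A (F i)) : HarmonicOff c A (∑ i ∈ s, F i) :=
  Finset.sum_induction F (HarmonicOff c A) (fun _ _ => HarmonicOff.add hc)
    (harmonicOff_const 0) hF

theorem HarmonicOff.mono {F : V → ℝ} (hF : HarmonicOff c A F) (hAW : A ⊆ W) :
    HarmonicOff c W F :=
  ⟨hF.1, fun u hu h => hF.2 u hu fun a ha => h a (hAW ha)⟩

theorem HarmonicOff.le (hc : Conductance c) (hA : A.Nonempty) {F : V → ℝ}
    (hF : HarmonicOff c A F) {m : ℝ} (h : ∀ a ∈ A, F a ≤ m) (x : V) : F x ≤ m := by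
  obtain ⟨a, ha⟩ := hA
  refine le_of_form_posPart_nonpos hc hF.1 (h a ha)
    (hF.2 _ (hF.1.posPart_sub hc m) fun b hb => ?_).le x
  exact max_eq_right (sub_nonpos.2 (h b hb))

theorem HarmonicOff.ge (hc : Conductance c) (hA : A.Nonempty) {F : V → ℝ}
    (hF : HarmonicOff c A F) {m : ℝ} (h : ∀ a ∈ A, m ≤ F a) (x : V) : m ≤ F x := by
  have := (hF.smul (-1)).le hc hA (m := -m) (fun a ha => by simpa using h a ha) x
  simpa using this

theorem HarmonicOff.ext (hc : Conductance c) (hA : A.Nonempty) {F G : V → ℝ}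
    (hF : HarmonicOff c A F) (hG : HarmonicOff c A G) (h : ∀ a ∈ A, F a = G a) : F = G := by
  have hFG := hF.add hc (hG.smul (-1))
  funext x
  have h1 := hFG.le hc hA (m := 0) (fun a ha => by simp [h a ha]) x
  have h2 := hFG.ge hc hA (m := 0) (fun a ha => by simp [h a ha]) x
  simp only [Pi.add_apply, Pi.smul_apply, smul_eq_mul] at h1 h2
  linarith

theorem finiteEnergy_ite_mem (hc : Conductance c) (A : Finset V) (f : V → ℝ) :
    FiniteEnergy c fun x => if x ∈ A then f x else 0 := by
  have h := FiniteEnergy.sum hc A fun a _ => (finiteEnergy_single hc a).smul (f a)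
  convert h using 1
  funext x
  simp [Finset.sum_apply, Pi.single_apply]

/-- Energy minimizers with prescribed values on a finite set `A` are harmonic off `A`. -/
theorem harmonicOff_of_minimal (hc : Conductance c) {h : V → ℝ}
    (hmin : ∀ f : V → ℝ, (∀ a ∈ A, f a = h a) → energy c h ≤ energy c f) :
    HarmonicOff c A h := by
  have hfin : FiniteEnergy c h := by
    have h0 := finiteEnergy_ite_mem hc A h
    have h1 := hmin (fun x => if x ∈ A then h x else 0) fun a ha => if_pos ha
    rw [h0.energy_eq hc] at h1
    exact finiteEnergy_of_energy_ne_top hc (ne_top_of_le_ne_top ENNReal.ofReal_ne_top h1)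
  refine ⟨hfin, fun u hu hu0 => ?_⟩
  have key : ∀ t : ℝ, 0 ≤ 2 * t * form c h u + t ^ 2 * form c u u := by
    intro t
    have htu := hu.smul t
    have h1 := hmin (h + t • u) fun a ha => by simp [hu0 a ha]
    have h2 := hfin.add hc htu
    rw [hfin.energy_eq hc, h2.energy_eq hc, ENNReal.ofReal_le_ofReal_iff
      (div_nonneg (form_self_nonneg hc _) zero_le_two), form_add_left hc hfin htu h2,
      form_smul_left, form_comm h (h + t • u), form_comm u (h + t • u), form_add_left hc hfin htu hfin,
      form_add_left hc hfin htu hu, form_smul_left, form_smul_left, form_comm u h] at h1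
    linarith
  have hu_nonneg := form_self_nonneg hc u
  by_contra hne
  rcases hu_nonneg.eq_or_lt with h0 | h0
  · have := key (-form c h u)
    rw [← h0] at this
    nlinarith [sq_pos_of_ne_zero hne]
  · have := key (-form c h u / form c u u)
    have h3 : 2 * (-form c h u / form c u u) * form c h u
        + (-form c h u / form c u u) ^ 2 * form c u u = -(form c h u ^ 2 / form c u u) := by
      field_simp
      ring
    rw [h3] at this
    linarith [div_pos (sq_pos_of_ne_zero hne) h0]

/-- A function harmonic off `W` is tested only through its values on `W`. -/
theorem HarmonicOff.form_eq_sum (hc : Conductance c) {F u : V → ℝ} (hF : HarmonicOff c W F)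
    (hu : FiniteEnergy c u) :
    form c F u = ∑ x ∈ W, u x * form c F (Pi.single x (1 : ℝ)) := by
  have hs : ∀ x ∈ W, FiniteEnergy c (u x • Pi.single x (1 : ℝ)) :=
    fun x _ => (finiteEnergy_single hc x).smul (u x)
  have hsum := FiniteEnergy.sum hc W hs
  have h1 := hF.2 (u + (-1 : ℝ) • ∑ x ∈ W, u x • Pi.single x (1 : ℝ))
    (hu.add hc (hsum.smul (-1))) fun a ha => by
      simp [Finset.sum_apply, Pi.single_apply, ha]
  rw [form_comm, form_add_left hc hu (hsum.smul _) hF.1, form_smul_left,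
    form_sum_left hc W hs hF.1] at h1
  simp only [form_smul_left] at h1
  rw [form_comm]
  simp only [form_comm F]
  linarith

theorem HarmonicOff.of_subset (hc : Conductance c) {F : V → ℝ} (hF : HarmonicOff c W F)
    (h : ∀ x ∈ W, x ∉ A → form c F (Pi.single x (1 : ℝ)) = 0) : HarmonicOff c A F := by
  refine ⟨hF.1, fun u hu hu0 => ?_⟩
  rw [hF.form_eq_sum hc hu]
  refine Finset.sum_eq_zero fun x hx => ?_
  by_cases hxA : x ∈ A
  · rw [hu0 x hxA, zero_mul]
  · rw [h x hx hxA, mul_zero]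

theorem conductance_tsum_pos [Infinite V] (hc : Conductance c) (x : V) : 0 < ∑' y, c x y := by
  obtain ⟨y, hy⟩ := exists_ne x
  rcases (hc.2.2.2.1 x y).cases_head with h | ⟨b, hb, -⟩
  · exact absurd h.symm hy
  · exact (hc.2.2.2.2 x).tsum_pos (hc.2.1 x) b hb

/-- One step of the network walk from `x`, in terms of the form. -/
theorem hasSum_walk [Infinite V] (hc : Conductance c) {F : V → ℝ} (hF : FiniteEnergy c F)
    (x : V) : HasSum (fun y => c x y / (∑' z, c x z) * F y)
      (F x - form c F (Pi.single x (1 : ℝ)) / (2 * ∑' z, c x z)) := by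
  have hpos := conductance_tsum_pos hc x
  have h1 := ((hF.summable_mul_sub hc x).hasSum.add
    ((hc.2.2.2.2 x).hasSum.mul_right (F x))).div_const (∑' z, c x z)
  have h2 : F x - form c F (Pi.single x (1 : ℝ)) / (2 * ∑' z, c x z) =
      (∑' y, c x y * (F y - F x) + (∑' y, c x y) * F x) / ∑' z, c x z := by
    rw [form_single hc hF x]
    field_simp
    ring
  rw [h2]
  exact h1.congr_fun fun y => by ring

/-- `H y`, for `y ∈ W`, is the harmonic extension off `W` of the indicator of `y`. -/
def IsHarmonicMeasure (c : V → V → ℝ) (W : Finset V) (H : V → V → ℝ) : Prop :=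
  ∀ y ∈ W, HarmonicOff c W (H y) ∧ H y y = 1 ∧ ∀ a ∈ W, a ≠ y → H y a = 0

namespace IsHarmonicMeasure

variable {H : V → V → ℝ}

theorem harmonicOff_sum (hc : Conductance c) (hH : IsHarmonicMeasure c W H) (f : V → ℝ) :
    HarmonicOff c W (∑ y ∈ W, f y • H y) :=
  HarmonicOff.sum hc W fun y hy => (hH y hy).1.smul (f y)

theorem sum_apply_of_mem (hH : IsHarmonicMeasure c W H) (f : V → ℝ) {x : V} (hx : x ∈ W) :
    (∑ y ∈ W, f y • H y) x = f x := by
  rw [Finset.sum_apply, Finset.sum_eq_single_of_mem x hx fun y hy hyx => ?_]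
  · simp [(hH x hx).2.1]
  · simp [(hH y hy).2.2 x hx hyx.symm]

theorem eq_sum (hc : Conductance c) (hH : IsHarmonicMeasure c W H) (hW : W.Nonempty)
    {F : V → ℝ} (hF : HarmonicOff c W F) : F = ∑ y ∈ W, F y • H y :=
  hF.ext hc hW (hH.harmonicOff_sum hc F) fun _ ha => (hH.sum_apply_of_mem F ha).symm

theorem nonneg (hc : Conductance c) (hH : IsHarmonicMeasure c W H) {y : V} (hy : y ∈ W)
    (x : V) : 0 ≤ H y x := by
  refine (hH y hy).1.ge hc ⟨y, hy⟩ (fun a ha => ?_) x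
  by_cases h : a = y
  · rw [h, (hH y hy).2.1]
    exact zero_le_one
  · rw [(hH y hy).2.2 a ha h]

theorem pW_nonneg (hc : Conductance c) (hH : IsHarmonicMeasure c W H) (x y : V) :
    0 ≤ pW c W H x y := by
  rw [pW]
  split_ifs with h1 h2
  · exact div_nonneg (hc.2.1 _ _) (tsum_nonneg (hc.2.1 x))
  · exact hH.nonneg hc h2 x
  · exact le_rfl

theorem hasSum_pW_of_mem [Infinite V] (hc : Conductance c) {F : V → ℝ}
    (hF : FiniteEnergy c F) {x : V} (hx : x ∈ W) :
    HasSum (fun y => pW c W H x y * F y)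
      (F x - form c F (Pi.single x (1 : ℝ)) / (2 * ∑' z, c x z)) := by
  simpa only [pW, if_pos hx] using hasSum_walk hc hF x

theorem hasSum_pW_of_notMem (hc : Conductance c) (hH : IsHarmonicMeasure c W H)
    (hW : W.Nonempty) {F : V → ℝ} (hF : HarmonicOff c W F) {x : V} (hx : x ∉ W) :
    HasSum (fun y => pW c W H x y * F y) (F x) := by
  have h1 : F x = ∑ y ∈ W, pW c W H x y * F y := by
    conv_lhs => rw [hH.eq_sum hc hW hF, Finset.sum_apply]
    refine Finset.sum_congr rfl fun y hy => ?_
    rw [pW, if_neg hx, if_pos hy, Pi.smul_apply, smul_eq_mul, mul_comm]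
  rw [h1]
  refine hasSum_sum_of_ne_finset_zero fun y hy => ?_
  rw [pW, if_neg hx, if_neg hy, zero_mul]

theorem hasSum_pW_of_harmonicOff [Infinite V] (hc : Conductance c)
    (hH : IsHarmonicMeasure c W H) (hW : W.Nonempty) (hAW : A ⊆ W) {F : V → ℝ}
    (hF : HarmonicOff c A F) {x : V} (hx : x ∉ A) :
    HasSum (fun y => pW c W H x y * F y) (F x) := by
  by_cases hxW : x ∈ W
  · have h1 := hasSum_pW_of_mem (H := H) hc hF.1 hxW
    rwa [hF.2 _ (finiteEnergy_single hc x) fun a ha => Pi.single_eq_of_ne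
      (ne_of_mem_of_not_mem ha hx) _, zero_div, sub_zero] at h1
  · exact hH.hasSum_pW_of_notMem hc hW (hF.mono hAW) hxW

/-- The Poisson problem on the trace of the network on `W`, with zero values on `A`. -/
theorem exists_poisson (hc : Conductance c) (hH : IsHarmonicMeasure c W H)
    (hA : A.Nonempty) (hAW : A ⊆ W) (g : V → ℝ) :
    ∃ G, HarmonicOff c W G ∧ (∀ a ∈ A, G a = 0) ∧
      ∀ x ∈ W, x ∉ A → form c G (Pi.single x (1 : ℝ)) = g x := by
  let M : Matrix W W ℝ := fun x y =>
    if x.1 ∈ A then (if x = y then 1 else 0) else form c (H y) (Pi.single x.1 (1 : ℝ))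
  let ext : (W → ℝ) → V → ℝ := fun f => ∑ y : W, f y • H y
  have hext : ∀ f, HarmonicOff c W (ext f) :=
    fun f => HarmonicOff.sum hc _ (F := fun y : W => f y • H y)
      fun y _ => (hH y y.2).1.smul (f y)
  have hext_apply : ∀ (f : W → ℝ) (x : W), ext f x = f x := by
    intro f x
    simp only [ext]
    rw [Finset.sum_apply, Finset.sum_eq_single_of_mem x (Finset.mem_univ x) fun y _ hyx => ?_]
    · simp [(hH x x.2).2.1]
    · simp [(hH y y.2).2.2 x x.2 fun h => hyx (Subtype.ext h.symm)]
  have hM_mem : ∀ (f : W → ℝ) (x : W), x.1 ∈ A → (M.mulVec f) x = f x := by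
    intro f x hx
    simp [M, Matrix.mulVec, dotProduct, hx]
  have hM_notMem : ∀ (f : W → ℝ) (x : W), x.1 ∉ A →
      (M.mulVec f) x = form c (ext f) (Pi.single x.1 (1 : ℝ)) := by
    intro f x hx
    simp only [ext]
    rw [form_sum_left hc _ (f := fun y : W => f y • H y)
      (fun y _ => (hH y y.2).1.1.smul (f y)) (finiteEnergy_single hc _)]
    simp [M, Matrix.mulVec, dotProduct, hx, form_smul_left, mul_comm]
  have hinj : Function.Injective M.mulVec := by
    refine (injective_iff_map_eq_zero M.mulVecLin).2 fun f hf => ?_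
    have hf0 : ∀ x, (M.mulVec f) x = 0 := congrFun hf
    have h1 : HarmonicOff c A (ext f) := (hext f).of_subset hc fun x hx hxA => by
      rw [← hM_notMem f ⟨x, hx⟩ hxA, hf0]
    have h2 := h1.ext hc hA (harmonicOff_const 0) fun a ha => by
      rw [hext_apply f ⟨a, hAW ha⟩, ← hM_mem f ⟨a, hAW ha⟩ ha, hf0]
    funext x
    exact (hext_apply f x).symm.trans (congrFun h2 x)
  obtain ⟨f, hf⟩ := Matrix.mulVec_surjective_iff_isUnit.2 (Matrix.mulVec_injective_iff_isUnit.1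
    hinj) fun x : W => if x.1 ∈ A then 0 else g x
  refine ⟨ext f, hext f, fun a ha => ?_, fun x hx hxA => ?_⟩
  · rw [hext_apply f ⟨a, hAW ha⟩, ← hM_mem f ⟨a, hAW ha⟩ ha, hf]
    exact if_pos ha
  · rw [← hM_notMem f ⟨x, hx⟩ hxA, hf]
    exact if_neg hxA

theorem tsum_ofReal_pW_mul (hc : Conductance c) (hH : IsHarmonicMeasure c W H) {F : V → ℝ}
    (hF : ∀ y, 0 ≤ F y) {x : V} {r : ℝ} (h : HasSum (fun y => pW c W H x y * F y) r) :
    ∑' y, ENNReal.ofReal (pW c W H x y) * ENNReal.ofReal (F y) = ENNReal.ofReal r := by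
  rw [← h.tsum_eq, ENNReal.ofReal_tsum_of_nonneg
    (fun y => mul_nonneg (hH.pW_nonneg hc x y) (hF y)) h.summable]
  exact tsum_congr fun y => (ENNReal.ofReal_mul (hH.pW_nonneg hc x y)).symm

/-- A Lyapunov function for the kernel `p_W`, decreasing in mean by at least `1` off `A`. -/
theorem exists_lyapunov [Infinite V] (hc : Conductance c) (hH : IsHarmonicMeasure c W H)
    (hA : A.Nonempty) (hAW : A ⊆ W) :
    ∃ L : V → ℝ≥0∞, (∀ x, L x ≠ ⊤) ∧
      ∀ x ∉ A, ∑' y, ENNReal.ofReal (pW c W H x y) * L y + 1 ≤ L x := by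
  obtain ⟨G, hG, hGA, hGW⟩ := hH.exists_poisson hc hA hAW fun x => 2 * ∑' y, c x y
  have hW := hA.mono hAW
  have hG0 : ∀ x, 0 ≤ G x := by
    intro x
    obtain ⟨a, ha⟩ := hA
    have hG' := hG.smul (-1)
    have h := le_of_form_posPart_nonpos hc hG'.1 (a := a) (m := 0) (by simp [hGA a ha]) ?_ x
    · simpa using h
    rw [hG'.form_eq_sum hc (hG'.1.posPart_sub hc 0)]
    refine Finset.sum_nonpos fun x hx => ?_
    by_cases hxA : x ∈ A
    · simp [hGA x hxA]
    · rw [form_smul_left, hGW x hx hxA]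
      refine mul_nonpos_of_nonneg_of_nonpos (le_max_right _ _) ?_
      linarith [conductance_tsum_pos hc x]
  have hF : HarmonicOff c W ((2 : ℝ) • G + fun _ => 1) :=
    (hG.smul 2).add hc (harmonicOff_const 1)
  refine ⟨fun x => ENNReal.ofReal (2 * G x + if x ∈ W then 0 else 1),
    fun x => ENNReal.ofReal_ne_top, fun x hxA => ?_⟩
  by_cases hx : x ∈ W
  · have h1 := hasSum_pW_of_mem (H := H) hc hF.1 hx
    rw [form_add_left hc (hG.1.smul 2) (finiteEnergy_const 1) (finiteEnergy_single hc x),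
      form_smul_left, hGW x hx hxA, form_const_left] at h1
    have h2 := hH.tsum_ofReal_pW_mul hc
      (fun y => by simpa using by linarith [hG0 y]) h1
    have h3 := h1.nonneg fun y => mul_nonneg (hH.pW_nonneg hc x y)
      (by simpa using by linarith [hG0 y])
    calc _ ≤ ∑' y, ENNReal.ofReal (pW c W H x y) *
            ENNReal.ofReal (((2 : ℝ) • G + fun _ => 1 : V → ℝ) y) + 1 := by
          gcongr with y
          simp only [Pi.add_apply, Pi.smul_apply, smul_eq_mul]
          refine ENNReal.ofReal_le_ofReal ?_
          split_ifs <;> linarith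
      _ ≤ _ := by
          have hpos := conductance_tsum_pos hc x
          beta_reduce
          rw [h2, ← ENNReal.ofReal_one, ← ENNReal.ofReal_add h3 zero_le_one, if_pos hx]
          refine ENNReal.ofReal_le_ofReal (le_of_eq ?_)
          simp only [Pi.add_apply, Pi.smul_apply, smul_eq_mul]
          field_simp
          ring
  · have h1 : HasSum (fun y => pW c W H x y * (2 * G y)) (2 * G x) :=
      hH.hasSum_pW_of_notMem hc hW (hG.smul 2) hx
    have h2 := hH.tsum_ofReal_pW_mul hc (fun y => mul_nonneg zero_le_two (hG0 y)) h1
    beta_reduce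
    rw [if_neg hx, ENNReal.ofReal_add (mul_nonneg zero_le_two (hG0 x)) zero_le_one,
      ENNReal.ofReal_one, ← h2]
    gcongr ?_ + 1
    refine ENNReal.tsum_le_tsum fun y => ?_
    by_cases hy : y ∈ W
    · simp [hy]
    · simp [pW, hx, hy]

end IsHarmonicMeasure

end DirichletForm

namespace HittingTime

variable {V Ω : Type*} {Y : ℕ → Ω → V} {A : Finset V}

/-- The process `Y` stopped upon entering `A`. -/
def stopped (A : Finset V) (Y : ℕ → Ω → V) : ℕ → Ω → V
  | 0 => Y 0
  | k + 1 => fun ω => if stopped A Y k ω ∈ A then stopped A Y k ω else Y (k + 1) ω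

theorem stopped_succ_of_mem {k : ℕ} {ω : Ω} (h : stopped A Y k ω ∈ A) :
    stopped A Y (k + 1) ω = stopped A Y k ω :=
  if_pos h

theorem stopped_succ_of_notMem {k : ℕ} {ω : Ω} (h : stopped A Y k ω ∉ A) :
    stopped A Y (k + 1) ω = Y (k + 1) ω :=
  if_neg h

theorem stopped_of_notMem {k : ℕ} {ω : Ω} (h : stopped A Y k ω ∉ A) :
    stopped A Y k ω = Y k ω := by
  cases k with
  | zero => rfl
  | succ k =>
    by_cases hk : stopped A Y k ω ∈ A
    · rw [stopped_succ_of_mem hk] at h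
      exact absurd hk h
    · exact stopped_succ_of_notMem hk

theorem stopped_mem_iff {k : ℕ} {ω : Ω} : stopped A Y k ω ∈ A ↔ ∃ i ≤ k, Y i ω ∈ A := by
  induction k with
  | zero => simp [stopped]
  | succ k ih =>
    by_cases hk : stopped A Y k ω ∈ A
    · obtain ⟨i, hi, hiA⟩ := ih.1 hk
      rw [stopped_succ_of_mem hk]
      exact ⟨fun _ => ⟨i, hi.trans k.le_succ, hiA⟩, fun _ => hk⟩
    · rw [stopped_succ_of_notMem hk]
      refine ⟨fun h => ⟨k + 1, le_rfl, h⟩, fun ⟨i, hi, hiA⟩ => ?_⟩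
      rcases Nat.le_succ_iff.1 hi with h | h
      · exact absurd (ih.2 ⟨i, h, hiA⟩) hk
      · subst h
        exact hiA

theorem stopped_eq_hit {k : ℕ} {ω : Ω} (hk : sInf {j | Y j ω ∈ A} ≤ k)
    (h : ∃ j, Y j ω ∈ A) : stopped A Y k ω = Y (sInf {j | Y j ω ∈ A}) ω := by
  have hmem : Y (sInf {j | Y j ω ∈ A}) ω ∈ A := Nat.sInf_mem (s := {j | Y j ω ∈ A}) h
  have hlt : ∀ i < sInf {j | Y j ω ∈ A}, Y i ω ∉ A := fun i hi => Nat.notMem_of_lt_sInf hi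
  induction k, hk using Nat.le_induction with
  | base =>
    generalize sInf {j | Y j ω ∈ A} = t at hmem hlt
    cases t with
    | zero => rfl
    | succ t =>
      refine if_neg fun hA => ?_
      obtain ⟨i, hi, hiA⟩ := stopped_mem_iff.1 hA
      exact hlt i (Nat.lt_succ_of_le hi) hiA
  | succ k hk ih =>
    rw [stopped_succ_of_mem (ih ▸ hmem), ih]

variable [MeasurableSpace Ω] {P : Measure Ω} {p : V → V → ℝ≥0∞} {z : V}

/-- `Y` is a Markov chain with kernel `p` started at `z`. -/
def IsMarkovChain (p : V → V → ℝ≥0∞) (z : V) (P : Measure Ω) (Y : ℕ → Ω → V) : Prop :=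
  ∀ (k : ℕ) (s : ℕ → V), P {ω | ∀ i ≤ k, Y i ω = s i} =
    (if s 0 = z then 1 else 0) * ∏ i ∈ Finset.range k, p (s i) (s (i + 1))

section

variable [Countable V]

/-- The Markov property, for events depending on the path up to time `k`. -/
theorem IsMarkovChain.measure_step (hY : IsMarkovChain p z P Y)
    (hYm : ∀ (j : ℕ) (s : V), MeasurableSet {ω | Y j ω = s}) {k : ℕ}
    {B : Set (Fin (k + 1) → V)} {x : V} (hB : ∀ s ∈ B, s (Fin.last k) = x) (y : V) :
    P ({ω | (fun i : Fin (k + 1) => Y i ω) ∈ B} ∩ {ω | Y (k + 1) ω = y}) =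
      P {ω | (fun i : Fin (k + 1) => Y i ω) ∈ B} * p x y := by
  set Z : Ω → Fin (k + 1) → V := fun ω i => Y i ω with hZ
  have hZm : ∀ s, MeasurableSet (Z ⁻¹' {s}) := fun s => by
    have : Z ⁻¹' {s} = ⋂ i : Fin (k + 1), {ω | Y i ω = s i} := by
      ext ω
      simp [hZ, funext_iff]
    rw [this]
    exact MeasurableSet.iInter fun i => hYm _ _
  have h1 : ∀ ν : Measure Ω, ν {ω | Z ω ∈ B} = ∑' s : B, ν (Z ⁻¹' {s.1}) := fun ν =>
    (tsum_measure_preimage_singleton B.to_countable fun s _ => hZm s).symm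
  have h2 := h1 (P.restrict {ω | Y (k + 1) ω = y})
  rw [Measure.restrict_apply' (hYm _ _)] at h2
  rw [h2, h1 P, ← ENNReal.tsum_mul_right]
  refine tsum_congr fun s => ?_
  rw [Measure.restrict_apply' (hYm _ _)]
  let s' : ℕ → V := fun i => if h : i < k + 1 then s.1 ⟨i, h⟩ else y
  have e1 : Z ⁻¹' {s.1} = {ω | ∀ i ≤ k, Y i ω = s' i} := by
    ext ω
    simp only [hZ, Set.mem_preimage, Set.mem_singleton_iff, funext_iff, Set.mem_ofPred_eq,
      Fin.forall_iff]
    refine forall_congr' fun i => ⟨fun h hi => ?_, fun h hi => ?_⟩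
    · simpa only [s', dif_pos (Nat.lt_succ_of_le hi)] using h (Nat.lt_succ_of_le hi)
    · simpa only [s', dif_pos hi] using h (Nat.le_of_lt_succ hi)
  have e2 : Z ⁻¹' {s.1} ∩ {ω | Y (k + 1) ω = y} = {ω | ∀ i ≤ k + 1, Y i ω = s' i} := by
    rw [e1]
    ext ω
    have hy : s' (k + 1) = y := dif_neg (lt_irrefl _)
    simp only [Set.mem_inter_iff, Set.mem_ofPred_eq, Nat.le_succ_iff, or_imp, forall_and,
      Nat.succ_eq_add_one, forall_eq, hy]
  have hx : s' k = x := (dif_pos k.lt_succ_self).trans (hB s.1 s.2)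
  have hy : s' (k + 1) = y := dif_neg (lt_irrefl _)
  rw [e2, e1, hY, hY, Finset.prod_range_succ, hx, hy, mul_assoc]

end

variable [MeasurableSpace V] [DiscreteMeasurableSpace V]

theorem measurable_stopped (hYm : ∀ j, Measurable (Y j)) (k : ℕ) :
    Measurable (stopped A Y k) := by
  induction k with
  | zero => exact hYm 0
  | succ k ih =>
    have hA : MeasurableSet {ω | stopped A Y k ω ∈ A} :=
      ih (MeasurableSet.of_discrete (s := (A : Set V)))
    exact Measurable.ite hA ih (hYm _)

theorem measurableSet_stopped_notMem (hYm : ∀ j, Measurable (Y j)) (k : ℕ) :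
    MeasurableSet {ω | stopped A Y k ω ∉ A} :=
  measurable_stopped hYm k (MeasurableSet.of_discrete (s := (A : Set V)ᶜ))

variable [Countable V]

theorem lintegral_comp_eq_tsum (μ : Measure Ω)
    {X : Ω → V} (hX : Measurable X) (g : V → ℝ≥0∞) :
    ∫⁻ ω, g (X ω) ∂μ = ∑' x, g x * μ (X ⁻¹' {x}) := by
  rw [← lintegral_map (measurable_of_countable g) hX, lintegral_countable']
  exact tsum_congr fun x => by rw [Measure.map_apply hX (measurableSet_singleton x)]

theorem IsMarkovChain.setLIntegral_step (hY : IsMarkovChain p z P Y)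
    (hYm : ∀ j, Measurable (Y j)) (g : V → ℝ≥0∞) (k : ℕ) :
    ∫⁻ ω in {ω | stopped A Y k ω ∉ A}, g (stopped A Y (k + 1) ω) ∂P =
      ∫⁻ ω in {ω | stopped A Y k ω ∉ A}, ∑' y, p (stopped A Y k ω) y * g y ∂P := by
  have hN := measurableSet_stopped_notMem (A := A) hYm k
  have e1 : ∫⁻ ω in {ω | stopped A Y k ω ∉ A}, g (stopped A Y (k + 1) ω) ∂P =
      ∫⁻ ω in {ω | stopped A Y k ω ∉ A}, g (Y (k + 1) ω) ∂P :=
    setLIntegral_congr_fun hN fun ω hω => congrArg g (stopped_succ_of_notMem hω)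
  have e2 : ∫⁻ ω in {ω | stopped A Y k ω ∉ A}, ∑' y, p (stopped A Y k ω) y * g y ∂P =
      ∫⁻ ω in {ω | stopped A Y k ω ∉ A}, ∑' y, p (Y k ω) y * g y ∂P :=
    setLIntegral_congr_fun hN fun ω hω =>
      congrArg (fun x => ∑' y, p x y * g y) (stopped_of_notMem hω)
  rw [e1, e2,
    lintegral_comp_eq_tsum _ (hYm (k + 1)) g,
    lintegral_comp_eq_tsum _ (hYm k) fun x => ∑' y, p x y * g y]
  set μ := P.restrict {ω | stopped A Y k ω ∉ A} with hμ
  have hstep : ∀ x y, μ (Y k ⁻¹' {x} ∩ Y (k + 1) ⁻¹' {y}) = μ (Y k ⁻¹' {x}) * p x y := by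
    intro x y
    have h := hY.measure_step (fun j s => hYm j (measurableSet_singleton s)) (k := k) (x := x)
      (B := {s | (∀ i, s i ∉ A) ∧ s (Fin.last k) = x}) (fun s hs => hs.2) y
    have e : {ω | (fun i : Fin (k + 1) => Y i ω) ∈
        {s : Fin (k + 1) → V | (∀ i, s i ∉ A) ∧ s (Fin.last k) = x}} =
        Y k ⁻¹' {x} ∩ {ω | stopped A Y k ω ∉ A} := by
      ext ω
      simp only [Set.mem_ofPred_eq, Set.mem_inter_iff, Set.mem_preimage, Set.mem_singleton_iff,
        stopped_mem_iff, Fin.forall_iff, Fin.val_last, not_exists, not_and, Nat.lt_succ_iff]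
      exact and_comm
    rw [e] at h
    rw [hμ, Measure.restrict_apply' hN, Measure.restrict_apply' hN, ← h]
    congr 1
    ext ω
    simp only [Set.mem_inter_iff, Set.mem_preimage, Set.mem_singleton_iff, Set.mem_ofPred_eq]
    tauto
  have hsum : ∀ y, μ (Y (k + 1) ⁻¹' {y}) = ∑' x, μ (Y k ⁻¹' {x}) * p x y := by
    intro y
    have h := lintegral_comp_eq_tsum (μ.restrict (Y (k + 1) ⁻¹' {y})) (hYm k) fun _ => 1
    have hy := hYm (k + 1) (measurableSet_singleton y)
    simp only [lintegral_one, Measure.restrict_apply' hy, Set.univ_inter, one_mul, hstep] at h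
    exact h
  simp only [hsum, ← ENNReal.tsum_mul_left, ← ENNReal.tsum_mul_right]
  rw [ENNReal.tsum_comm]
  exact tsum_congr fun x => tsum_congr fun y => by ring

theorem IsMarkovChain.lintegral_stopped_succ (hY : IsMarkovChain p z P Y)
    (hYm : ∀ j, Measurable (Y j)) (g : V → ℝ≥0∞) (k : ℕ) :
    ∫⁻ ω, g (stopped A Y (k + 1) ω) ∂P =
      ∫⁻ ω in {ω | stopped A Y k ω ∉ A}, ∑' y, p (stopped A Y k ω) y * g y ∂P +
      ∫⁻ ω in {ω | stopped A Y k ω ∉ A}ᶜ, g (stopped A Y k ω) ∂P := by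
  have hN := measurableSet_stopped_notMem (A := A) hYm k
  rw [← lintegral_add_compl _ hN, hY.setLIntegral_step hYm g k]
  congr 1
  refine setLIntegral_congr_fun hN.compl fun ω hω => ?_
  exact congrArg g (stopped_succ_of_mem (not_not.1 hω))

theorem IsMarkovChain.lintegral_stopped_zero [IsProbabilityMeasure P]
    (hY : IsMarkovChain p z P Y) (hYm : ∀ j, Measurable (Y j)) (g : V → ℝ≥0∞) :
    ∫⁻ ω, g (stopped A Y 0 ω) ∂P = g z := by
  have h0 : P {ω | Y 0 ω = z} = 1 := by simpa using hY 0 fun _ => z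
  have hae : ∀ᵐ ω ∂P, Y 0 ω = z :=
    (prob_compl_eq_zero_iff (hYm 0 (measurableSet_singleton z))).2 h0
  rw [lintegral_congr_ae (g := fun _ => g z) (hae.mono fun ω hω => by simp only [stopped, hω])]
  simp

/-- Optional stopping for functions that are harmonic off `A`. -/
theorem IsMarkovChain.lintegral_stopped [IsProbabilityMeasure P] (hY : IsMarkovChain p z P Y)
    (hYm : ∀ j, Measurable (Y j)) {g : V → ℝ≥0∞} (hg : ∀ x ∉ A, ∑' y, p x y * g y = g x)
    (k : ℕ) : ∫⁻ ω, g (stopped A Y k ω) ∂P = g z := by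
  induction k with
  | zero => exact hY.lintegral_stopped_zero hYm g
  | succ k ih =>
    have hN := measurableSet_stopped_notMem (A := A) hYm k
    rw [hY.lintegral_stopped_succ hYm, ← ih,
      ← lintegral_add_compl (μ := P) (fun ω => g (stopped A Y k ω)) hN]
    congr 1
    exact setLIntegral_congr_fun hN fun ω hω => hg _ hω

theorem IsMarkovChain.lintegral_stopped_lyapunov [IsProbabilityMeasure P]
    (hY : IsMarkovChain p z P Y) (hYm : ∀ j, Measurable (Y j)) {L : V → ℝ≥0∞}
    (hL : ∀ x ∉ A, ∑' y, p x y * L y + 1 ≤ L x) (k : ℕ) :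
    ∫⁻ ω, L (stopped A Y k ω) ∂P + k * P {ω | ∀ j, Y j ω ∉ A} ≤ L z := by
  induction k with
  | zero => simp [hY.lintegral_stopped_zero hYm L]
  | succ k ih =>
    refine le_trans ?_ ih
    have hN := measurableSet_stopped_notMem (A := A) hYm k
    have hle : P {ω | ∀ j, Y j ω ∉ A} ≤ P {ω | stopped A Y k ω ∉ A} :=
      measure_mono fun ω hω h => by
        obtain ⟨i, -, hi⟩ := stopped_mem_iff.1 h
        exact hω i hi
    have hstep : ∫⁻ ω in {ω | stopped A Y k ω ∉ A}, ∑' y, p (stopped A Y k ω) y * L y ∂P +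
        P {ω | stopped A Y k ω ∉ A} ≤
        ∫⁻ ω in {ω | stopped A Y k ω ∉ A}, L (stopped A Y k ω) ∂P := by
      rw [← setLIntegral_one, ← lintegral_add_right _ measurable_const]
      exact setLIntegral_mono' hN fun ω hω => hL _ hω
    rw [hY.lintegral_stopped_succ hYm,
      ← lintegral_add_compl (μ := P) (fun ω => L (stopped A Y k ω)) hN]
    push_cast
    calc _ = (∫⁻ ω in {ω | stopped A Y k ω ∉ A}, ∑' y, p (stopped A Y k ω) y * L y ∂P +
            P {ω | ∀ j, Y j ω ∉ A}) +
          ∫⁻ ω in {ω | stopped A Y k ω ∉ A}ᶜ, L (stopped A Y k ω) ∂P +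
            k * P {ω | ∀ j, Y j ω ∉ A} := by ring
      _ ≤ _ := by
        gcongr
        exact (add_le_add le_rfl hle).trans hstep

theorem IsMarkovChain.ae_exists_mem [IsProbabilityMeasure P] (hY : IsMarkovChain p z P Y)
    (hYm : ∀ j, Measurable (Y j)) {L : V → ℝ≥0∞} (hLz : L z ≠ ⊤)
    (hL : ∀ x ∉ A, ∑' y, p x y * L y + 1 ≤ L x) : ∀ᵐ ω ∂P, ∃ j, Y j ω ∈ A := by
  have h0 : P {ω | ∀ j, Y j ω ∉ A} = 0 := by
    by_contra hne
    obtain ⟨k, hk⟩ := ENNReal.exists_nat_mul_gt hne hLz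
    exact hk.not_ge (le_add_self.trans (hY.lintegral_stopped_lyapunov hYm hL k))
  rw [ae_iff]
  simpa only [not_exists] using h0

/-- The mean of a bounded function at the hitting time of `A`. -/
theorem IsMarkovChain.integral_hit [IsProbabilityMeasure P] (hY : IsMarkovChain p z P Y)
    (hYm : ∀ j, Measurable (Y j)) (hhit : ∀ᵐ ω ∂P, ∃ j, Y j ω ∈ A) {f : V → ℝ} {C : ℝ}
    (hfC : ∀ x, |f x| ≤ C)
    (hf : ∀ x ∉ A, ∑' y, p x y * ENNReal.ofReal (f y + C) = ENNReal.ofReal (f x + C)) :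
    ∫ ω, f (Y (sInf {j | Y j ω ∈ A}) ω) ∂P = f z := by
  have hnn : ∀ x, 0 ≤ f x + C := fun x => by linarith [neg_le_of_abs_le (hfC x)]
  have hmeas : ∀ k, AEStronglyMeasurable (fun ω => f (stopped A Y k ω)) P := fun k =>
    ((measurable_of_countable f).comp (measurable_stopped hYm k)).aestronglyMeasurable
  have hbound : ∀ k, ∀ᵐ ω ∂P, ‖f (stopped A Y k ω)‖ ≤ C :=
    fun k => Filter.Eventually.of_forall fun ω => hfC _
  have hconst : ∀ k, ∫ ω, f (stopped A Y k ω) ∂P = f z := fun k => by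
    have h1 : ∫ ω, (f (stopped A Y k ω) + C) ∂P = f z + C := by
      rw [integral_eq_lintegral_of_nonneg_ae (Filter.Eventually.of_forall fun ω => hnn _)
        ((hmeas k).add aestronglyMeasurable_const),
        hY.lintegral_stopped hYm (g := fun x => ENNReal.ofReal (f x + C)) hf k,
        ENNReal.toReal_ofReal (hnn z)]
    rw [integral_add (Integrable.of_bound (hmeas k) C (hbound k)) (integrable_const C)] at h1
    simpa using h1
  have hlim := tendsto_integral_of_dominated_convergence (μ := P)
    (F := fun k ω => f (stopped A Y k ω)) (f := fun ω => f (Y (sInf {j | Y j ω ∈ A}) ω))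
    (fun _ => C) hmeas (integrable_const C) hbound
    (hhit.mono fun ω hω => tendsto_const_nhds.congr'
      ((Filter.eventually_ge_atTop (sInf {j | Y j ω ∈ A})).mono fun k hk =>
        congrArg f (stopped_eq_hit hk hω).symm))
  simp only [hconst] at hlim
  exact tendsto_nhds_unique hlim tendsto_const_nhds

end HittingTime

/-- The paper's Lemma 3.2: for the Markov chain with kernel `p_W` started at `z ∈ W`,
the hitting time `τ` of a nonempty `A ⊆ W` is a.s. finite, and for every boundary
datum `φ` on `A`, `E[φ(Y_τ)] = h^φ(z)` where `h^φ` is the energy-minimizing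
extension of `φ` from `A`. -/
theorem stmt12 {V : Type*} [Countable V] [Infinite V]
    (c : V → V → ℝ) (hc : Conductance c)
    (A W : Finset V) (hA : A.Nonempty) (hAW : A ⊆ W)
    (z : V) (hz : z ∈ W)
    -- the harmonic-measure functions for the boundary set `W`
    (H : V → V → ℝ)
    (hHb : ∀ y ∈ W, H y y = 1 ∧ ∀ a ∈ W, a ≠ y → H y a = 0)
    (hHm : ∀ y ∈ W, ∀ f : V → ℝ,
      (f y = 1 ∧ ∀ a ∈ W, a ≠ y → f a = 0) → energy c (H y) ≤ energy c f)
    -- a Markov chain with kernel `p_W` started at `z`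
    {Ω : Type*} [MeasurableSpace Ω] (P : Measure Ω) [IsProbabilityMeasure P]
    (Y : ℕ → Ω → V)
    (hYmeas : ∀ (j : ℕ) (s : V), MeasurableSet {ω | Y j ω = s})
    (hMarkov : ∀ (k : ℕ) (s : ℕ → V),
      P {ω | ∀ i ≤ k, Y i ω = s i} =
        (if s 0 = z then 1 else 0) *
          ∏ i ∈ Finset.range k, ENNReal.ofReal (pW c W H (s i) (s (i + 1)))) :
    P {ω | ∃ j, Y j ω ∈ A} = 1 ∧
      ∀ (φ h : V → ℝ),
        (∀ a ∈ A, h a = φ a) →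
        (∀ f : V → ℝ, (∀ a ∈ A, f a = φ a) → energy c h ≤ energy c f) →
        ∫ ω, φ (Y (sInf {j | Y j ω ∈ A}) ω) ∂P = h z := by
  have hH : DirichletForm.IsHarmonicMeasure c W H := fun y hy =>
    ⟨DirichletForm.harmonicOff_of_minimal hc fun f hf => hHm y hy f
      ⟨by rw [hf y hy, (hHb y hy).1], fun a ha hay => by rw [hf a ha, (hHb y hy).2 a ha hay]⟩,
      hHb y hy⟩
  have hY : HittingTime.IsMarkovChain (fun x y => ENNReal.ofReal (pW c W H x y)) z P Y := hMarkov
  let _ : MeasurableSpace V := ⊤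
  have hYm : ∀ j, Measurable (Y j) := fun j => measurable_to_countable' fun s => hYmeas j s
  obtain ⟨L, hL_top, hL⟩ := hH.exists_lyapunov hc hA hAW
  have hhit := hY.ae_exists_mem hYm (hL_top z) hL
  have hmeas : MeasurableSet {ω | ∃ j, Y j ω ∈ A} := by
    rw [Set.ofPred_exists]
    exact MeasurableSet.iUnion fun j => hYm j (MeasurableSet.of_discrete (s := (A : Set V)))
  refine ⟨(mem_ae_iff_prob_eq_one hmeas).1 hhit, fun φ h hφ hmin => ?_⟩
  have hh : DirichletForm.HarmonicOff c A h := DirichletForm.harmonicOff_of_minimal hc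
    fun f hf => hmin f fun a ha => (hf a ha).trans (hφ a ha)
  obtain ⟨m, hm⟩ : ∃ m, ∀ a ∈ A, |h a| ≤ m :=
    ⟨∑ a ∈ A, |h a|, fun a ha => Finset.single_le_sum (f := fun a => |h a|)
      (fun b _ => abs_nonneg _) ha⟩
  have hle := hh.le hc hA fun a ha => (abs_le.1 (hm a ha)).2
  have hge := hh.ge hc hA fun a ha => (abs_le.1 (hm a ha)).1
  have hhm : DirichletForm.HarmonicOff c A (h + fun _ => m) :=
    hh.add hc (DirichletForm.harmonicOff_const m)
  have hnn : ∀ x, 0 ≤ (h + fun _ => m : V → ℝ) x := fun x => by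
    simp only [Pi.add_apply]
    linarith [hge x]
  have key := hY.integral_hit hYm hhit (fun x => abs_le.2 ⟨hge x, hle x⟩) fun x hx =>
    hH.tsum_ofReal_pW_mul hc hnn (hH.hasSum_pW_of_harmonicOff hc (hA.mono hAW) hAW hhm hx)
  rw [← key]
  refine integral_congr_ae (hhit.mono fun ω hω => ?_)
  exact (hφ _ (Nat.sInf_mem (s := {j | Y j ω ∈ A}) hω)).symm
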